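/- Quantitative core of Theorem 1 (measure-and-reprogram, single input, averaged over a uniformly random oracle): Let q ≥ 1, fix x ∈ 𝒳, a vector φ₀ ∈ V, linear maps A₁,…,A_q on V each of which is a unitary possibly composed with an orthogonal projection, and for every Θ ∈ 𝒴 an orthogonal projection π_Θ on EuclideanSpace ℂ Z; write G_{x,Θ} := X_x ∘ Π_Θ where Π_Θ is the lift of π_Θ to V. Then (1/|𝒴|^{|𝒳|}) Σ_{H : 𝒳 → 𝒴} (1/|𝒴|) Σ_{Θ ∈ 𝒴} (1/(2q+1)) Σ_{(i,b) ∈ R_q} ‖G_{x,Θ} (A^{H*Θx}_{i+b→q} (A^H_{i→i+b} (X_x (A^H_{0→i} φ₀))))‖² ≥ (1/(2q+1)²) · (1/|𝒴|^{|𝒳|}) Σ_{H : 𝒳 → 𝒴} ‖G_{x,H(x)} φ_q^H‖². -/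

import Mathlib

/- Setting: `V = EuclideanSpace ℂ (Bool × 𝒳 × 𝒴 × Z)`, the oracle operator `O_H`,
the query projection `X_x`, reprogramming `Function.update H x Θ`, the partial runs
`A^K_{i→j}`, the lift of a projection on `EuclideanSpace ℂ Z` to `V`,
and the index set `R_q = ({0,…,q−1} × {0,1}) ∪ {(q,0)}`. -/

variable {𝒳 𝒴 Z : Type*} [Fintype 𝒳] [DecidableEq 𝒳] [Nonempty 𝒳]
  [Fintype 𝒴] [AddCommGroup 𝒴] [Fintype Z] [Nonempty Z]

/-- The oracle operator `O_H`, determined on the standard basis by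
`O_H e_{(c,ξ,y,z)} = e_{(c,ξ,y + (if c then H ξ else 0), z)}`. -/
noncomputable def oracleOp (H : 𝒳 → 𝒴) :
    EuclideanSpace ℂ (Bool × 𝒳 × 𝒴 × Z) →ₗ[ℂ] EuclideanSpace ℂ (Bool × 𝒳 × 𝒴 × Z) where
  toFun v := WithLp.toLp 2 fun p => v (p.1, p.2.1, p.2.2.1 - (if p.1 then H p.2.1 else 0), p.2.2.2)
  map_add' _ _ := rfl
  map_smul' _ _ := rfl

/-- The orthogonal projection `X_x` onto queries at `x`. -/
noncomputable def Xproj (x : 𝒳) :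
    EuclideanSpace ℂ (Bool × 𝒳 × 𝒴 × Z) →ₗ[ℂ] EuclideanSpace ℂ (Bool × 𝒳 × 𝒴 × Z) where
  toFun v := WithLp.toLp 2 fun p => if p.2.1 = x then v p else 0
  map_add' u v := PiLp.ext fun p => by by_cases h : p.2.1 = x <;> simp [h]
  map_smul' c v := PiLp.ext fun p => by by_cases h : p.2.1 = x <;> simp [h]

/-- The lift to `V` of an operator `π` on `EuclideanSpace ℂ Z`, acting as the identity on
the `Bool`, `𝒳`, `𝒴` coordinates. -/
noncomputable def liftZ (π : EuclideanSpace ℂ Z →ₗ[ℂ] EuclideanSpace ℂ Z) :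
    EuclideanSpace ℂ (Bool × 𝒳 × 𝒴 × Z) →ₗ[ℂ] EuclideanSpace ℂ (Bool × 𝒳 × 𝒴 × Z) where
  toFun v := WithLp.toLp 2 fun p => π (WithLp.toLp 2 fun z => v (p.1, p.2.1, p.2.2.1, z)) p.2.2.2
  map_add' u v := PiLp.ext fun p => by
    have h : (WithLp.toLp 2 fun z => (u + v) (p.1, p.2.1, p.2.2.1, z))
        = ((WithLp.toLp 2 fun z => u (p.1, p.2.1, p.2.2.1, z)) : EuclideanSpace ℂ Z)
          + ((WithLp.toLp 2 fun z => v (p.1, p.2.1, p.2.2.1, z)) : EuclideanSpace ℂ Z) := rfl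
    show π (WithLp.toLp 2 fun z => (u + v) (p.1, p.2.1, p.2.2.1, z)) p.2.2.2 = _
    rw [h, map_add]
    rfl
  map_smul' c v := PiLp.ext fun p => by
    have h : (WithLp.toLp 2 fun z => (c • v) (p.1, p.2.1, p.2.2.1, z))
        = c • ((WithLp.toLp 2 fun z => v (p.1, p.2.1, p.2.2.1, z)) : EuclideanSpace ℂ Z) := rfl
    show π (WithLp.toLp 2 fun z => (c • v) (p.1, p.2.1, p.2.2.1, z)) p.2.2.2 = _
    rw [h, map_smul]
    rfl

/-- `AComp A K i j = A^K_{i→j} = A_j ∘ O_K ∘ ⋯ ∘ A_{i+1} ∘ O_K` (the identity if `j ≤ i`). -/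
noncomputable def AComp
    (A : ℕ → (EuclideanSpace ℂ (Bool × 𝒳 × 𝒴 × Z) →ₗ[ℂ] EuclideanSpace ℂ (Bool × 𝒳 × 𝒴 × Z)))
    (K : 𝒳 → 𝒴) (i : ℕ) :
    ℕ → (EuclideanSpace ℂ (Bool × 𝒳 × 𝒴 × Z) →ₗ[ℂ] EuclideanSpace ℂ (Bool × 𝒳 × 𝒴 × Z))
  | 0 => LinearMap.id
  | j + 1 => if i ≤ j then A (j + 1) ∘ₗ oracleOp K ∘ₗ AComp A K i j else LinearMap.id

/-- An orthogonal projection: idempotent and self-adjoint. -/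
def IsOrthProjection {E : Type*} [NormedAddCommGroup E] [InnerProductSpace ℂ E]
    (P : E →ₗ[ℂ] E) : Prop :=
  P ∘ₗ P = P ∧ ∀ u v : E, (inner ℂ (P u) v : ℂ) = inner ℂ u (P v)

/-- A unitary map: bijective and norm-preserving. -/
def IsUnitaryOp {E : Type*} [NormedAddCommGroup E] [InnerProductSpace ℂ E]
    (U : E →ₗ[ℂ] E) : Prop :=
  Function.Bijective U ∧ ∀ v : E, ‖U v‖ = ‖v‖

/-- `R_q = ({0,…,q−1} × {0,1}) ∪ {(q,0)}`, a set of `2q+1` pairs `(i,b)`. -/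
def Rq (q : ℕ) : Finset (ℕ × ℕ) := (Finset.range q ×ˢ {0, 1}) ∪ {(q, 0)}

theorem AComp_self
    (A : ℕ → (EuclideanSpace ℂ (Bool × 𝒳 × 𝒴 × Z) →ₗ[ℂ] EuclideanSpace ℂ (Bool × 𝒳 × 𝒴 × Z)))
    (K : 𝒳 → 𝒴) (i : ℕ) : AComp A K i i = LinearMap.id := by
  cases i <;> simp [AComp]

theorem AComp_succ
    (A : ℕ → (EuclideanSpace ℂ (Bool × 𝒳 × 𝒴 × Z) →ₗ[ℂ] EuclideanSpace ℂ (Bool × 𝒳 × 𝒴 × Z)))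
    (K : 𝒳 → 𝒴) (i j : ℕ) (h : i ≤ j) (v : EuclideanSpace ℂ (Bool × 𝒳 × 𝒴 × Z)) :
    AComp A K i (j + 1) v = A (j + 1) (oracleOp K (AComp A K i j v)) := by
  simp [AComp, h]

theorem AComp_head
    (A : ℕ → (EuclideanSpace ℂ (Bool × 𝒳 × 𝒴 × Z) →ₗ[ℂ] EuclideanSpace ℂ (Bool × 𝒳 × 𝒴 × Z)))
    (K : 𝒳 → 𝒴) (i q : ℕ) (h : i < q) (v : EuclideanSpace ℂ (Bool × 𝒳 × 𝒴 × Z)) :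
    AComp A K i q v = AComp A K (i + 1) q (A (i + 1) (oracleOp K v)) := by
  induction q with
  | zero => omega
  | succ q ih =>
    rw [AComp_succ A K i q (by omega)]
    rcases Nat.lt_or_ge i q with h1 | h1
    · rw [ih h1, AComp_succ A K (i + 1) q (by omega)]
    · obtain rfl : i = q := by omega
      simp [AComp_self]

theorem oracleOp_coord (H : 𝒳 → 𝒴) (v : EuclideanSpace ℂ (Bool × 𝒳 × 𝒴 × Z))
    (c : Bool) (ξ : 𝒳) (y : 𝒴) (z : Z) :
    oracleOp H v (c, ξ, y, z) = v (c, ξ, y - (if c then H ξ else 0), z) := rfl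

theorem Xproj_coord (x : 𝒳) (v : EuclideanSpace ℂ (Bool × 𝒳 × 𝒴 × Z))
    (c : Bool) (ξ : 𝒳) (y : 𝒴) (z : Z) :
    Xproj x v (c, ξ, y, z) = if ξ = x then v (c, ξ, y, z) else 0 := rfl

theorem oracle_diff (H : 𝒳 → 𝒴) (x : 𝒳) (Θ : 𝒴)
    (v : EuclideanSpace ℂ (Bool × 𝒳 × 𝒴 × Z)) :
    oracleOp (Function.update H x Θ) v - oracleOp H v =
      oracleOp (Function.update H x Θ) (Xproj x v) - oracleOp H (Xproj x v) := by
  refine PiLp.ext fun p => ?_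
  obtain ⟨c, ξ, y, z⟩ := p
  by_cases h : ξ = x
  · subst h
    simp [oracleOp_coord, Xproj_coord]
  · simp [oracleOp_coord, Xproj_coord, h]

theorem G_Xproj (x : 𝒳) (p : EuclideanSpace ℂ Z →ₗ[ℂ] EuclideanSpace ℂ Z)
    (v : EuclideanSpace ℂ (Bool × 𝒳 × 𝒴 × Z)) :
    (Xproj x ∘ₗ liftZ p) (Xproj x v) = (Xproj x ∘ₗ liftZ p) v := by
  refine PiLp.ext fun r => ?_
  obtain ⟨c, ξ, y, z⟩ := r
  by_cases h : ξ = x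
  · subst h
    simp [Xproj, liftZ]
  · simp [Xproj, h]

theorem telescope (q : ℕ) (x : 𝒳)
    (φ₀ : EuclideanSpace ℂ (Bool × 𝒳 × 𝒴 × Z))
    (A : ℕ → (EuclideanSpace ℂ (Bool × 𝒳 × 𝒴 × Z) →ₗ[ℂ] EuclideanSpace ℂ (Bool × 𝒳 × 𝒴 × Z)))
    (H : 𝒳 → 𝒴) (Θ : 𝒴) :
    AComp A (Function.update H x Θ) 0 q φ₀ = AComp A H 0 q φ₀ +
      ∑ i ∈ Finset.range q,
        (AComp A (Function.update H x Θ) i q (Xproj x (AComp A H 0 i φ₀)) -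
          AComp A (Function.update H x Θ) (i + 1) q
            (AComp A H i (i + 1) (Xproj x (AComp A H 0 i φ₀)))) := by
  have key : ∀ i ∈ Finset.range q,
      (AComp A (Function.update H x Θ) i q (Xproj x (AComp A H 0 i φ₀)) -
          AComp A (Function.update H x Θ) (i + 1) q
            (AComp A H i (i + 1) (Xproj x (AComp A H 0 i φ₀)))) =
      AComp A (Function.update H x Θ) i q (AComp A H 0 i φ₀) -
        AComp A (Function.update H x Θ) (i + 1) q (AComp A H 0 (i + 1) φ₀) := by
    intro i hi
    have hi' := Finset.mem_range.mp hi
    rw [AComp_head _ _ i q hi', AComp_head _ _ i q hi', AComp_succ _ _ i i le_rfl,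
      AComp_succ _ _ 0 i (Nat.zero_le _), AComp_self, LinearMap.id_apply,
      ← map_sub, ← map_sub, ← map_sub, ← map_sub, ← oracle_diff]
  rw [Finset.sum_congr rfl key,
    Finset.sum_range_sub' (fun i => AComp A (Function.update H x Θ) i q (AComp A H 0 i φ₀)),
    AComp_self, AComp_self]
  simp

theorem sum_Rq {M : Type*} [AddCommMonoid M] (q : ℕ) (f : ℕ × ℕ → M) :
    ∑ r ∈ Rq q, f r = f (q, 0) + ∑ i ∈ Finset.range q, (f (i, 0) + f (i, 1)) := by
  unfold Rq
  rw [Finset.sum_union (by simp), Finset.sum_product, Finset.sum_singleton, add_comm]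
  simp

theorem card_Rq (q : ℕ) : ((Rq q).card : ℝ) = 2 * (q : ℝ) + 1 := by
  have h := sum_Rq q (fun _ => (1 : ℝ))
  simp at h
  rw [h]; ring

theorem norm_sum_sq_le {ι E : Type*} [SeminormedAddCommGroup E] (s : Finset ι) (f : ι → E) :
    ‖∑ i ∈ s, f i‖ ^ 2 ≤ (s.card : ℝ) * ∑ i ∈ s, ‖f i‖ ^ 2 :=
  (pow_le_pow_left₀ (norm_nonneg _) (norm_sum_le _ _) 2).trans sq_sum_le_card_mul_sum_sq

theorem pointwise (q : ℕ) (x : 𝒳)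
    (φ₀ : EuclideanSpace ℂ (Bool × 𝒳 × 𝒴 × Z))
    (A : ℕ → (EuclideanSpace ℂ (Bool × 𝒳 × 𝒴 × Z) →ₗ[ℂ] EuclideanSpace ℂ (Bool × 𝒳 × 𝒴 × Z)))
    (p : EuclideanSpace ℂ Z →ₗ[ℂ] EuclideanSpace ℂ Z) (H : 𝒳 → 𝒴) (Θ : 𝒴) :
    ‖(Xproj x ∘ₗ liftZ p) (AComp A (Function.update H x Θ) 0 q φ₀)‖ ^ 2 ≤
      (2 * (q : ℝ) + 1) * ∑ r ∈ Rq q,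
        ‖(Xproj x ∘ₗ liftZ p)
          (AComp A (Function.update H x Θ) (r.1 + r.2) q
            (AComp A H r.1 (r.1 + r.2) (Xproj x (AComp A H 0 r.1 φ₀))))‖ ^ 2 := by
  set G : EuclideanSpace ℂ (Bool × 𝒳 × 𝒴 × Z) →ₗ[ℂ] EuclideanSpace ℂ (Bool × 𝒳 × 𝒴 × Z) :=
    Xproj x ∘ₗ liftZ p with hG
  have h : G (AComp A (Function.update H x Θ) 0 q φ₀) = ∑ r ∈ Rq q, ((-1 : ℤ) ^ r.2) •
      G (AComp A (Function.update H x Θ) (r.1 + r.2) q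
            (AComp A H r.1 (r.1 + r.2) (Xproj x (AComp A H 0 r.1 φ₀)))) := by
    rw [sum_Rq, telescope, map_add, map_sum]
    simp only [add_zero, AComp_self, LinearMap.id_apply, pow_zero, one_smul, pow_one, neg_smul,
      map_sub, ← sub_eq_add_neg]
    rw [hG, G_Xproj]
  rw [h, ← card_Rq]
  refine (norm_sum_sq_le _ _).trans (le_of_eq ?_)
  congr 1
  refine Finset.sum_congr rfl fun r _ => ?_
  rcases neg_one_pow_eq_or ℤ r.2 with h | h <;> rw [h] <;> simp

theorem sum_update (f : (𝒳 → 𝒴) → ℝ) (x : 𝒳) :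
    ∑ H : 𝒳 → 𝒴, ∑ Θ : 𝒴, f (Function.update H x Θ) =
      (Fintype.card 𝒴 : ℝ) * ∑ H : 𝒳 → 𝒴, f H := by
  have hinv : Function.Involutive
      (fun a : (𝒳 → 𝒴) × 𝒴 => (Function.update a.1 x a.2, a.1 x)) := by
    rintro ⟨H, Θ⟩
    simp
  have h := Equiv.sum_comp hinv.toPerm (fun a : (𝒳 → 𝒴) × 𝒴 => f a.1)
  rw [Fintype.sum_prod_type, Fintype.sum_prod_type] at h
  simp only [Function.Involutive.coe_toPerm] at h
  rw [h]
  simp [Finset.mul_sum]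

/-- Quantitative core of Theorem 1 (measure-and-reprogram, single input,
averaged over a uniformly random oracle `H` and a uniformly random `Θ`):
`(1/|𝒴|^{|𝒳|}) Σ_H (1/|𝒴|) Σ_Θ (1/(2q+1)) Σ_{(i,b) ∈ R_q}`
`    ‖G_{x,Θ} (A^{H*Θx}_{i+b→q} (A^H_{i→i+b} (X_x (A^H_{0→i} φ₀))))‖²`
`  ≥ (1/(2q+1)²) · (1/|𝒴|^{|𝒳|}) Σ_H ‖G_{x,H(x)} φ_q^H‖²`. -/
theorem measure_and_reprogram_single_averaged (q : ℕ) (hq : 1 ≤ q) (x : 𝒳)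
    (φ₀ : EuclideanSpace ℂ (Bool × 𝒳 × 𝒴 × Z))
    (A : ℕ → (EuclideanSpace ℂ (Bool × 𝒳 × 𝒴 × Z) →ₗ[ℂ] EuclideanSpace ℂ (Bool × 𝒳 × 𝒴 × Z)))
    (hA : ∀ k, 1 ≤ k → k ≤ q →
      ∃ U P, IsUnitaryOp U ∧ IsOrthProjection P ∧ (A k = U ∘ₗ P ∨ A k = P ∘ₗ U))
    (π : 𝒴 → (EuclideanSpace ℂ Z →ₗ[ℂ] EuclideanSpace ℂ Z))
    (hπ : ∀ Θ : 𝒴, IsOrthProjection (π Θ)) :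
    (1 / ((Fintype.card 𝒴 : ℝ) ^ (Fintype.card 𝒳))) *
        ∑ H : 𝒳 → 𝒴,
          (1 / (Fintype.card 𝒴 : ℝ)) *
            ∑ Θ : 𝒴,
              (1 / (2 * (q : ℝ) + 1)) *
                ∑ r ∈ Rq q,
                  ‖(Xproj x ∘ₗ liftZ (π Θ))
                      (AComp A (Function.update H x Θ) (r.1 + r.2) q
                        (AComp A H r.1 (r.1 + r.2) (Xproj x (AComp A H 0 r.1 φ₀))))‖ ^ 2
      ≥ (1 / (2 * (q : ℝ) + 1) ^ 2) *
          ((1 / ((Fintype.card 𝒴 : ℝ) ^ (Fintype.card 𝒳))) *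
            ∑ H : 𝒳 → 𝒴, ‖(Xproj x ∘ₗ liftZ (π (H x))) (AComp A H 0 q φ₀)‖ ^ 2) := by
  have hc : (0 : ℝ) < Fintype.card 𝒴 := by exact_mod_cast Fintype.card_pos
  have hq0 : (0 : ℝ) < 2 * (q : ℝ) + 1 := by positivity
  have hs := sum_update
    (fun K : 𝒳 → 𝒴 => ‖(Xproj x ∘ₗ liftZ (π (K x))) (AComp A K 0 q φ₀)‖ ^ 2) x
  simp only [Function.update_self] at hs
  have hs' : ∑ H : 𝒳 → 𝒴, ‖(Xproj x ∘ₗ liftZ (π (H x))) (AComp A H 0 q φ₀)‖ ^ 2 =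
      ∑ H : 𝒳 → 𝒴, (1 / (Fintype.card 𝒴 : ℝ)) * ∑ Θ : 𝒴,
        ‖(Xproj x ∘ₗ liftZ (π Θ)) (AComp A (Function.update H x Θ) 0 q φ₀)‖ ^ 2 := by
    rw [← Finset.mul_sum, hs]
    field_simp
  rw [hs', ge_iff_le, mul_left_comm]
  refine mul_le_mul_of_nonneg_left ?_ (by positivity)
  rw [Finset.mul_sum]
  refine Finset.sum_le_sum fun H _ => ?_
  rw [mul_left_comm]
  refine mul_le_mul_of_nonneg_left ?_ (by positivity)
  rw [Finset.mul_sum]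
  refine Finset.sum_le_sum fun Θ _ => ?_
  refine (mul_le_mul_of_nonneg_left (pointwise q x φ₀ A (π Θ) H Θ) (by positivity)).trans
    (le_of_eq ?_)
  rw [← mul_assoc]
  congr 1
  field_simp
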